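/- arXiv:2305.14615 — 2 statements merged into one kernel-verified Lean document; each statement's English description precedes it below -/
import Mathlib

section
/- Iteration for the boundary C^{1,α} estimate: Let γ < 1, let ᾱ ∈ (0,1) and C₁ > 1 be the constants of the homogeneous model problem, let α ∈ (0,ᾱ) with α ≤ 1−γ, and let δ > 0 and η > 0 be the constants of the approximation step for this α. Suppose u ∈ C(closure Q₁⁺) satisfies u ∈ S*(λ,Λ,f) in Q₁⁺, u = g on ∂_p Q₁⁺ ∩ {x_n = 0}, ‖u‖_{L^∞(Q₁⁺)} ≤ 1, ‖f‖_{L^∞(Q₁⁺)} ≤ δ, and |g(x,t)| ≤ (δ/2^{1+α})(|x| + |t|^{1/(2−γ)})^{1+α} for all (x,t) ∈ ∂_p Q₁⁺ ∩ {x_n = 0}. Then there exists a sequence of reals {a_k}_{k=−1}^∞ with a_{−1} = a₀ = 0 such that for all k ≥ 0: ‖u − a_k x_n‖_{L^∞(Q_{η^k}⁺)} ≤ η^{k(1+α)} and |a_k − a_{k−1}| ≤ C₁ η^{(k−1)α}. -/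
noncomputable section

open Real Topology Filter Set MeasureTheory

namespace DPP

/-- Space-time points. -/
abbrev Pt (n : ℕ) := (Fin n → ℝ) × ℝ

/-- The last index of `Fin n`. -/
def lastIdx (n : ℕ) [NeZero n] : Fin n :=
  ⟨n - 1, Nat.sub_lt (Nat.pos_of_ne_zero (NeZero.ne n)) one_pos⟩

/-- The last spatial coordinate `x_n`. -/
def xlast {n : ℕ} [NeZero n] (x : Fin n → ℝ) : ℝ := x (lastIdx n)

/-- Euclidean norm on `Fin n → ℝ`. -/
def eucNorm {n : ℕ} (x : Fin n → ℝ) : ℝ := Real.sqrt (∑ i, (x i) ^ 2)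

/-- Euclidean norm of the first `n-1` coordinates (the `x'` part). -/
def eucNormPrime {n : ℕ} [NeZero n] (x : Fin n → ℝ) : ℝ :=
  Real.sqrt (∑ i, if i = lastIdx n then 0 else (x i) ^ 2)

/-- Frobenius norm of a matrix. -/
def matNorm {n : ℕ} (M : Matrix (Fin n) (Fin n) ℝ) : ℝ :=
  Real.sqrt (∑ i, ∑ j, (M i j) ^ 2)

/-- The intrinsic parabolic quasidistance `|x-y| + |t-s|^(1/(2-γ))`. -/
def pdist {n : ℕ} (γ : ℝ) (p q : Pt n) : ℝ :=
  eucNorm (p.1 - q.1) + |p.2 - q.2| ^ ((1 : ℝ) / (2 - γ))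

/-- The intrinsic cylinder `Q_r(x₀,t₀)`. -/
def Qcyl {n : ℕ} (γ r : ℝ) (x₀ : Fin n → ℝ) (t₀ : ℝ) : Set (Pt n) :=
  {p | eucNorm (p.1 - x₀) < r ∧ t₀ - r ^ (2 - γ) < p.2 ∧ p.2 ≤ t₀}

/-- The upper intrinsic cylinder `Q_r⁺(x₀,t₀)`. -/
def Qp {n : ℕ} [NeZero n] (γ r : ℝ) (x₀ : Fin n → ℝ) (t₀ : ℝ) : Set (Pt n) :=
  {p ∈ Qcyl γ r x₀ t₀ | 0 < xlast p.1}

/-- `Q₁⁺`. -/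
def Q1p (n : ℕ) [NeZero n] (γ : ℝ) : Set (Pt n) := Qp γ 1 (0 : Fin n → ℝ) 0

/-- The parabolic boundary of `Q₁⁺`. -/
def pbQ1p (n : ℕ) [NeZero n] (γ : ℝ) : Set (Pt n) := closure (Q1p n γ) \ Q1p n γ

/-- The flat part `∂_p Q₁⁺ ∩ {x_n = 0}`. -/
def flatQ1p (n : ℕ) [NeZero n] (γ : ℝ) : Set (Pt n) :=
  {p ∈ pbQ1p n γ | xlast p.1 = 0}

/-- Symmetric matrices `A` with `λ I ≤ A ≤ Λ I`. -/
def ellipticMats (n : ℕ) (lam Lam : ℝ) : Set (Matrix (Fin n) (Fin n) ℝ) :=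
  {A | A.IsSymm ∧ ∀ v : Fin n → ℝ,
    lam * ∑ i, (v i) ^ 2 ≤ ∑ i, ∑ j, A i j * v i * v j ∧
    ∑ i, ∑ j, A i j * v i * v j ≤ Lam * ∑ i, (v i) ^ 2}

/-- Pucci maximal operator `𝓜⁺`. -/
def pucciPlus {n : ℕ} (lam Lam : ℝ) (M : Matrix (Fin n) (Fin n) ℝ) : ℝ :=
  sSup ((fun A => (A * M).trace) '' ellipticMats n lam Lam)

/-- Pucci minimal operator `𝓜⁻`. -/
def pucciMinus {n : ℕ} (lam Lam : ℝ) (M : Matrix (Fin n) (Fin n) ℝ) : ℝ :=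
  sInf ((fun A => (A * M).trace) '' ellipticMats n lam Lam)

/-- A test function: continuous, `C¹` in time and `C²` in space. -/
def IsTestFn {n : ℕ} (φ : Pt n → ℝ) : Prop :=
  Continuous φ ∧ (∀ x : Fin n → ℝ, ContDiff ℝ 1 fun t => φ (x, t)) ∧
    ∀ t : ℝ, ContDiff ℝ 2 fun x => φ (x, t)

/-- The time derivative of `φ` at `p`. -/
def timeD {n : ℕ} (φ : Pt n → ℝ) (p : Pt n) : ℝ := deriv (fun s => φ (p.1, s)) p.2

/-- The spatial gradient of `φ` at `p`. -/
def spaceGrad {n : ℕ} (φ : Pt n → ℝ) (p : Pt n) : Fin n → ℝ :=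
  fun i => fderiv ℝ (fun x => φ (x, p.2)) p.1 (Pi.single i 1)

/-- The spatial Hessian of `φ` at `p`. -/
def hess {n : ℕ} (φ : Pt n → ℝ) (p : Pt n) : Matrix (Fin n) (Fin n) ℝ :=
  fun i j =>
    fderiv ℝ (fun x => fderiv ℝ (fun y => φ (y, p.2)) x (Pi.single j 1)) p.1 (Pi.single i 1)

/-- `φ` touches `u` from above at `p` within `Ω`. -/
def TouchAbove {n : ℕ} (u φ : Pt n → ℝ) (Ω : Set (Pt n)) (p : Pt n) : Prop :=
  u p = φ p ∧ ∀ᶠ q in 𝓝[Ω] p, u q ≤ φ q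

/-- `φ` touches `u` from below at `p` within `Ω`. -/
def TouchBelow {n : ℕ} (u φ : Pt n → ℝ) (Ω : Set (Pt n)) (p : Pt n) : Prop :=
  u p = φ p ∧ ∀ᶠ q in 𝓝[Ω] p, φ q ≤ u q

/-- Viscosity subsolution of `u_t - x_n^γ F(D²u, x, t) = f` in `Ω`. -/
def ViscSub {n : ℕ} [NeZero n] (γ : ℝ) (F : Matrix (Fin n) (Fin n) ℝ → Pt n → ℝ)
    (f u : Pt n → ℝ) (Ω : Set (Pt n)) : Prop :=
  ∀ p ∈ Ω, ∀ φ : Pt n → ℝ, IsTestFn φ → TouchAbove u φ Ω p →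
    timeD φ p - xlast p.1 ^ γ * F (hess φ p) p ≤ f p

/-- Viscosity supersolution of `u_t - x_n^γ F(D²u, x, t) = f` in `Ω`. -/
def ViscSuper {n : ℕ} [NeZero n] (γ : ℝ) (F : Matrix (Fin n) (Fin n) ℝ → Pt n → ℝ)
    (f u : Pt n → ℝ) (Ω : Set (Pt n)) : Prop :=
  ∀ p ∈ Ω, ∀ φ : Pt n → ℝ, IsTestFn φ → TouchBelow u φ Ω p →
    f p ≤ timeD φ p - xlast p.1 ^ γ * F (hess φ p) p

/-- The sup norm of `u` over `S`. -/
def supAbs {n : ℕ} (u : Pt n → ℝ) (S : Set (Pt n)) : ℝ := ⨆ p : S, |u ↑p|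

/-- The solution class `S*(λ,Λ,f)` in `Ω`. -/
def InSstar {n : ℕ} [NeZero n] (γ lam Lam : ℝ) (f u : Pt n → ℝ) (Ω : Set (Pt n)) : Prop :=
  ViscSub γ (fun M _ => pucciPlus lam Lam M) (fun _ => supAbs f Ω) u Ω ∧
  ViscSuper γ (fun M _ => pucciMinus lam Lam M) (fun _ => -supAbs f Ω) u Ω

/-- The solution class `S(λ,Λ,0)` in `Ω`. -/
def InS0 {n : ℕ} [NeZero n] (γ lam Lam : ℝ) (u : Pt n → ℝ) (Ω : Set (Pt n)) : Prop :=
  ViscSub γ (fun M _ => pucciPlus lam Lam M) (fun _ => 0) u Ω ∧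
  ViscSuper γ (fun M _ => pucciMinus lam Lam M) (fun _ => 0) u Ω

/-- The boundary `C^{1,ᾱ}` estimate for the homogeneous model problem, with constants
`abar` and `C₁`. -/
def ModelEstimate (n : ℕ) [NeZero n] (γ lam Lam abar C₁ : ℝ) : Prop :=
  ∀ u : Pt n → ℝ, ContinuousOn u (closure (Q1p n γ)) →
    InS0 γ lam Lam u (Q1p n γ) →
    (∀ p ∈ flatQ1p n γ, u p = 0) →
    supAbs u (Q1p n γ) ≤ 1 →
    ∃ a : ℝ, |a| ≤ C₁ ∧ ∀ p ∈ closure (Qp γ (1/2) (0 : Fin n → ℝ) 0),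
      |u p - a * xlast p.1| ≤
        C₁ * (eucNorm p.1 + |p.2| ^ ((1 : ℝ) / (2 - γ))) ^ abar * xlast p.1

/-- Structure condition (F1): uniform parabolicity. -/
def UnifParab (n : ℕ) (lam Lam : ℝ) (F : Matrix (Fin n) (Fin n) ℝ → Pt n → ℝ) : Prop :=
  ∀ M N : Matrix (Fin n) (Fin n) ℝ, M.IsSymm → N.IsSymm → ∀ p : Pt n,
    pucciMinus lam Lam (M - N) ≤ F M p - F N p ∧ F M p - F N p ≤ pucciPlus lam Lam (M - N)

/-- Structure condition (F2): `F` is concave or convex in the matrix variable. -/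
def ConcaveOrConvex (n : ℕ) (F : Matrix (Fin n) (Fin n) ℝ → Pt n → ℝ) : Prop :=
  (∀ p : Pt n, ConvexOn ℝ Set.univ fun M => F M p) ∨
  (∀ p : Pt n, ConcaveOn ℝ Set.univ fun M => F M p)

/-- The Hessian matrix of the quadratic polynomial `P(x) = ∑ i, a i * x i * x n`. -/
def quadMat (n : ℕ) [NeZero n] (a : Fin n → ℝ) : Matrix (Fin n) (Fin n) ℝ :=
  fun i j => (if j = lastIdx n then a i else 0) + (if i = lastIdx n then a j else 0)

/-- The parabolic boundary of a general set `S ⊆ ℝ^{n+1}`. -/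
def pBdry {n : ℕ} (γ : ℝ) (S : Set (Pt n)) : Set (Pt n) :=
  {p ∈ frontier S | ∀ r : ℝ, 0 < r → (Qcyl γ r p.1 p.2 ∩ Sᶜ).Nonempty}

end DPP

open DPP

namespace DPP

lemma xlast_smul {n : ℕ} [NeZero n] (r : ℝ) (x : Fin n → ℝ) : xlast (r • x) = r * xlast x := rfl

lemma eucNorm_smul {n : ℕ} {r : ℝ} (hr : 0 ≤ r) (x : Fin n → ℝ) :
    eucNorm (r • x) = r * eucNorm x := by
  unfold eucNorm
  have : ∑ i, ((r • x) i) ^ 2 = r ^ 2 * ∑ i, (x i) ^ 2 := by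
    rw [Finset.mul_sum]
    refine Finset.sum_congr rfl fun i _ => ?_
    simp [mul_pow]
  rw [this, Real.sqrt_mul (sq_nonneg r), Real.sqrt_sq hr]

lemma eucNorm_nonneg {n : ℕ} (x : Fin n → ℝ) : 0 ≤ eucNorm x := Real.sqrt_nonneg _

lemma continuous_eucNorm {n : ℕ} : Continuous (eucNorm : (Fin n → ℝ) → ℝ) := by
  unfold eucNorm
  fun_prop

lemma continuous_xlast {n : ℕ} [NeZero n] : Continuous (xlast : (Fin n → ℝ) → ℝ) := by
  unfold xlast
  fun_prop

lemma abs_le_eucNorm {n : ℕ} (x : Fin n → ℝ) (i : Fin n) : |x i| ≤ eucNorm x := by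
  unfold eucNorm
  apply Real.abs_le_sqrt
  exact Finset.single_le_sum (f := fun i => (x i) ^ 2) (fun i _ => sq_nonneg _) (Finset.mem_univ i)

lemma mem_Qp {n : ℕ} [NeZero n] {γ r : ℝ} {p : Pt n} :
    p ∈ Qp γ r (0 : Fin n → ℝ) 0 ↔
      eucNorm p.1 < r ∧ -r ^ (2 - γ) < p.2 ∧ p.2 ≤ 0 ∧ 0 < xlast p.1 := by
  simp [Qp, Qcyl, and_assoc]

lemma mem_Q1p {n : ℕ} [NeZero n] {γ : ℝ} {p : Pt n} :
    p ∈ Q1p n γ ↔ eucNorm p.1 < 1 ∧ -1 < p.2 ∧ p.2 ≤ 0 ∧ 0 < xlast p.1 := by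
  unfold Q1p
  rw [mem_Qp]
  simp

/-- The scaling map. -/
def scl {n : ℕ} (r T : ℝ) (p : Pt n) : Pt n := (r • p.1, T * p.2)

lemma continuous_scl {n : ℕ} (r T : ℝ) : Continuous (scl r T : Pt n → Pt n) := by
  unfold scl
  fun_prop

lemma scl_inv {n : ℕ} {r T : ℝ} (hr : r ≠ 0) (hT : T ≠ 0) (p : Pt n) :
    scl r⁻¹ T⁻¹ (scl r T p) = p := by
  ext <;> simp [scl, hr, hT]

lemma scl_inv' {n : ℕ} {r T : ℝ} (hr : r ≠ 0) (hT : T ≠ 0) (p : Pt n) :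
    scl r T (scl r⁻¹ T⁻¹ p) = p := by
  ext <;> simp [scl, hr, hT]

lemma closure_bounds {n : ℕ} [NeZero n] {γ : ℝ} {p : Pt n} (hp : p ∈ closure (Q1p n γ)) :
    eucNorm p.1 ≤ 1 ∧ -1 ≤ p.2 ∧ p.2 ≤ 0 ∧ 0 ≤ xlast p.1 := by
  have hcl : IsClosed {p : Pt n | eucNorm p.1 ≤ 1 ∧ -1 ≤ p.2 ∧ p.2 ≤ 0 ∧ 0 ≤ xlast p.1} := by
    refine ((isClosed_le (continuous_eucNorm.comp continuous_fst) continuous_const).inter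
      ((isClosed_le continuous_const continuous_snd).inter
      ((isClosed_le continuous_snd continuous_const).inter
      (isClosed_le continuous_const (continuous_xlast.comp continuous_fst)))))
  refine (closure_minimal ?_ hcl) hp
  intro q hq
  rw [mem_Q1p] at hq
  exact ⟨hq.1.le, hq.2.1.le, hq.2.2.1, hq.2.2.2.le⟩

lemma isCompact_closure_Q1p (n : ℕ) [NeZero n] (γ : ℝ) : IsCompact (closure (Q1p n γ)) := by
  apply Metric.isCompact_of_isClosed_isBounded isClosed_closure
  refine (Metric.isBounded_closedBall (x := (0 : Pt n)) (r := 1)).subset ?_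
  intro p hp
  obtain ⟨h1, h2, h3, _⟩ := closure_bounds hp
  rw [mem_closedBall_zero_iff, Prod.norm_def]
  refine max_le ?_ ?_
  · rw [pi_norm_le_iff_of_nonneg zero_le_one]
    intro i
    exact (abs_le_eucNorm p.1 i).trans h1
  · rw [Real.norm_eq_abs, abs_le]
    constructor <;> linarith

lemma abs_le_supAbs {n : ℕ} [NeZero n] {γ : ℝ} {u : Pt n → ℝ}
    (hu : ContinuousOn u (closure (Q1p n γ))) {p : Pt n} (hp : p ∈ Q1p n γ) :
    |u p| ≤ supAbs u (Q1p n γ) := by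
  obtain ⟨C, hC⟩ := (isCompact_closure_Q1p n γ).exists_bound_of_continuousOn hu
  unfold supAbs
  refine le_ciSup (f := fun p : Q1p n γ => |u ↑p|) ?_ ⟨p, hp⟩
  refine ⟨C, ?_⟩
  rintro _ ⟨q, rfl⟩
  exact hC q (subset_closure q.2)

lemma supAbs_le {n : ℕ} {u : Pt n → ℝ} {S : Set (Pt n)} {C : ℝ} (hC : 0 ≤ C)
    (h : ∀ p ∈ S, |u p| ≤ C) : supAbs u S ≤ C :=
  Real.iSup_le (fun p => h p p.2) hC

lemma supAbs_nonneg {n : ℕ} (u : Pt n → ℝ) (S : Set (Pt n)) : 0 ≤ supAbs u S :=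
  Real.iSup_nonneg fun _ => abs_nonneg _

lemma Q1p_nonempty (n : ℕ) [NeZero n] (γ : ℝ) : (Q1p n γ).Nonempty := by
  refine ⟨(Pi.single (lastIdx n) (1/2), 0), ?_⟩
  rw [mem_Q1p]
  refine ⟨?_, by norm_num, by norm_num, by simp [xlast]⟩
  unfold eucNorm
  rw [Real.sqrt_lt' one_pos, Finset.sum_eq_single (lastIdx n)]
  · norm_num
  · intro b _ hb
    simp [hb]
  · simp

lemma supAbs_const {n : ℕ} [NeZero n] {γ c : ℝ} (hc : 0 ≤ c) :
    supAbs (fun _ => c) (Q1p n γ) = c := by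
  haveI := (Q1p_nonempty n γ).to_subtype
  simp [supAbs, abs_of_nonneg hc]

lemma pucciPlus_smul {n : ℕ} (lam Lam : ℝ) {c : ℝ} (hc : 0 ≤ c) (M : Matrix (Fin n) (Fin n) ℝ) :
    pucciPlus lam Lam (c • M) = c * pucciPlus lam Lam M := by
  unfold pucciPlus
  rw [← smul_eq_mul, ← Real.sSup_smul_of_nonneg hc, ← Set.image_smul, Set.image_image]
  simp

lemma pucciMinus_smul {n : ℕ} (lam Lam : ℝ) {c : ℝ} (hc : 0 ≤ c) (M : Matrix (Fin n) (Fin n) ℝ) :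
    pucciMinus lam Lam (c • M) = c * pucciMinus lam Lam M := by
  unfold pucciMinus
  rw [← smul_eq_mul, ← Real.sInf_smul_of_nonneg hc, ← Set.image_smul, Set.image_image]
  simp

/-- The rescaled test function. -/
def psi {n : ℕ} [NeZero n] (c r T a : ℝ) (φ : Pt n → ℝ) (q : Pt n) : ℝ :=
  c * φ (scl r⁻¹ T⁻¹ q) + a * xlast q.1

lemma contDiff_xlast {n : ℕ} [NeZero n] {m : WithTop ℕ∞} :
    ContDiff ℝ m (xlast : (Fin n → ℝ) → ℝ) := by
  unfold xlast
  fun_prop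

lemma isTestFn_psi {n : ℕ} [NeZero n] (c r T a : ℝ) {φ : Pt n → ℝ} (h : IsTestFn φ) :
    IsTestFn (psi c r T a φ) := by
  obtain ⟨h0, h1, h2⟩ := h
  refine ⟨?_, ?_, ?_⟩
  · unfold psi
    exact (continuous_const.mul (h0.comp (continuous_scl _ _))).add
      (continuous_const.mul (continuous_xlast.comp continuous_fst))
  · intro x
    have := (h1 (r⁻¹ • x)).comp (contDiff_const.mul contDiff_id : ContDiff ℝ 1 fun t : ℝ => T⁻¹ * id t)
    exact (contDiff_const.mul this).add (contDiff_const (c := a * xlast x))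
  · intro t
    have := (h2 (T⁻¹ * t)).comp (contDiff_id.const_smul r⁻¹ : ContDiff ℝ 2 fun x : Fin n → ℝ => r⁻¹ • id x)
    exact (contDiff_const.mul this).add (contDiff_const.mul contDiff_xlast)

lemma timeD_psi {n : ℕ} [NeZero n] {c r T a : ℝ} (hr : r ≠ 0) (hT : T ≠ 0)
    {φ : Pt n → ℝ} (h : IsTestFn φ) (p : Pt n) :
    timeD (psi c r T a φ) (scl r T p) = c * T⁻¹ * timeD φ p := by
  have hd : HasDerivAt (fun s => φ (p.1, s)) (timeD φ p) (T⁻¹ * (T * p.2)) := by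
    have : T⁻¹ * (T * p.2) = p.2 := by field_simp
    rw [this]
    exact (((h.2.1 p.1).differentiable one_ne_zero) p.2).hasDerivAt
  have h2 : HasDerivAt (fun s : ℝ => T⁻¹ * s) T⁻¹ (T * p.2) := by
    simpa using (hasDerivAt_id (T * p.2)).const_mul T⁻¹
  have h3 := ((hd.comp (T * p.2) h2).const_mul c).add_const (a * xlast (r • p.1))
  have h4 := h3.deriv
  unfold timeD
  have e : (fun s => psi c r T a φ ((scl r T p).1, s)) =
      fun s => c * ((fun s => φ (p.1, s)) ∘ fun s => T⁻¹ * s) s + a * xlast (r • p.1) := by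
    funext s
    simp [psi, scl, smul_smul, hr]
  rw [e]
  change deriv _ (T * p.2) = _
  rw [h4]
  unfold timeD
  ring

/-- xlast as a continuous linear map. -/
def xlastL (n : ℕ) [NeZero n] : (Fin n → ℝ) →L[ℝ] ℝ := ContinuousLinearMap.proj (lastIdx n)

lemma hess_psi {n : ℕ} [NeZero n] {c r T a : ℝ} (hr : r ≠ 0) (hT : T ≠ 0)
    {φ : Pt n → ℝ} (h : IsTestFn φ) (p : Pt n) :
    hess (psi c r T a φ) (scl r T p) = (c * r⁻¹ ^ 2) • hess φ p := by
  set Φ : (Fin n → ℝ) → ℝ := fun x => φ (x, p.2) with hΦ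
  have hΦ2 : ContDiff ℝ 2 Φ := h.2.2 p.2
  have hsc : ∀ x : Fin n → ℝ, HasFDerivAt (fun y : Fin n → ℝ => r⁻¹ • y)
      (r⁻¹ • ContinuousLinearMap.id ℝ (Fin n → ℝ)) x := fun x => (hasFDerivAt_id x).const_smul r⁻¹
  have e : (fun y => psi c r T a φ (y, (scl r T p).2)) =
      fun y => c * (Φ ∘ fun y => r⁻¹ • y) y + a * xlastL n y := by
    funext s
    simp [psi, scl, hT, hΦ, xlast, xlastL]
  have e1 : ∀ x (j : Fin n), fderiv ℝ (fun y => psi c r T a φ (y, (scl r T p).2)) x (Pi.single j 1) =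
      c * r⁻¹ * ((fun z => fderiv ℝ Φ z (Pi.single j 1)) ∘ fun y => r⁻¹ • y) x
        + a * xlastL n (Pi.single j 1) := by
    intro x j
    rw [e]
    have hd : HasFDerivAt Φ (fderiv ℝ Φ (r⁻¹ • x)) (r⁻¹ • x) :=
      ((hΦ2.differentiable two_ne_zero) _).hasFDerivAt
    have h3 := ((hd.comp x (hsc x)).const_mul c).add (((xlastL n).hasFDerivAt (x := x)).const_mul a)
    have h4 := h3.fderiv
    erw [h4]
    simp
    ring
  ext i j
  change fderiv ℝ (fun x => fderiv ℝ (fun y => psi c r T a φ (y, (scl r T p).2)) x (Pi.single j 1))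
    (r • p.1) (Pi.single i 1) = _
  have e2 := funext fun x => e1 x j
  rw [e2]
  have hp : r⁻¹ • (r • p.1) = p.1 := by rw [smul_smul, inv_mul_cancel₀ hr, one_smul]
  have hd : HasFDerivAt (fun z => fderiv ℝ Φ z (Pi.single j 1))
      (fderiv ℝ (fun z => fderiv ℝ Φ z (Pi.single j 1)) p.1) (r⁻¹ • (r • p.1)) := by
    rw [hp]
    have : ContDiff ℝ 1 (fderiv ℝ Φ) := hΦ2.fderiv_right (by norm_num)
    have := (this.clm_apply (contDiff_const (c := (Pi.single j 1 : Fin n → ℝ))))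
    exact ((this.differentiable one_ne_zero) _).hasFDerivAt
  have h3 := ((hd.comp (r • p.1) (hsc _)).const_mul (c * r⁻¹)).add_const
    (a * xlastL n (Pi.single j 1))
  rw [h3.fderiv]
  simp [hess, hΦ]
  ring

lemma scl_mem {n : ℕ} [NeZero n] {γ r : ℝ} (hr : 0 < r) {ρ : ℝ} (hρ : 0 < ρ) {p : Pt n} :
    scl r (r ^ (2 - γ)) p ∈ Qp γ (ρ * r) (0 : Fin n → ℝ) 0 ↔ p ∈ Qp γ ρ (0 : Fin n → ℝ) 0 := by
  rw [mem_Qp, mem_Qp]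
  have hT : 0 < r ^ (2 - γ) := Real.rpow_pos_of_pos hr _
  simp only [scl, eucNorm_smul hr.le, xlast_smul, Real.mul_rpow hρ.le hr.le]
  refine and_congr ?_ (and_congr ?_ (and_congr ?_ ?_))
  · rw [mul_comm ρ, mul_lt_mul_iff_right₀ hr]
  · rw [← neg_mul, mul_comm (-_), mul_lt_mul_iff_right₀ hT]
  · constructor
    · intro h; by_contra h'; push Not at h'; nlinarith [mul_pos hT h']
    · intro h; nlinarith
  · exact mul_pos_iff_of_pos_left hr

lemma Qp_mono {n : ℕ} [NeZero n] {γ r s : ℝ} (hγ : γ < 1) (hr : 0 < r) (hrs : r ≤ s) :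
    Qp γ r (0 : Fin n → ℝ) 0 ⊆ Qp γ s (0 : Fin n → ℝ) 0 := by
  intro p hp
  rw [mem_Qp] at hp ⊢
  have := Real.rpow_le_rpow hr.le hrs (by linarith : 0 ≤ 2 - γ)
  exact ⟨by linarith [hp.1], by linarith [hp.2.1], hp.2.2⟩

lemma scl_mem_Q1p {n : ℕ} [NeZero n] {γ r : ℝ} (hγ : γ < 1) (hr : 0 < r) (hr1 : r ≤ 1) {p : Pt n}
    (hp : p ∈ Q1p n γ) : scl r (r ^ (2 - γ)) p ∈ Q1p n γ := by
  have := (scl_mem (n := n) (γ := γ) hr one_pos (p := p)).2 hp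
  rw [one_mul] at this
  exact Qp_mono hγ hr hr1 this

lemma tendsto_scl {n : ℕ} [NeZero n] {γ r : ℝ} (hr : 0 < r) {p : Pt n}
    (hp : p ∈ Q1p n γ) :
    Tendsto (scl r⁻¹ (r ^ (2 - γ))⁻¹) (𝓝[Q1p n γ] (scl r (r ^ (2 - γ)) p)) (𝓝[Q1p n γ] p) := by
  have hT : 0 < r ^ (2 - γ) := Real.rpow_pos_of_pos hr _
  set T := r ^ (2 - γ)
  have hc : Tendsto (scl r⁻¹ T⁻¹) (𝓝 (scl r T p)) (𝓝 p) := by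
    have := (continuous_scl (n := n) r⁻¹ T⁻¹).tendsto (scl r T p)
    rwa [scl_inv hr.ne' hT.ne'] at this
  refine tendsto_nhdsWithin_iff.2 ⟨hc.mono_left nhdsWithin_le_nhds, ?_⟩
  rw [mem_Q1p] at hp
  have o1 : ∀ᶠ q : Pt n in 𝓝 p, eucNorm q.1 < 1 :=
    (isOpen_lt (continuous_eucNorm.comp continuous_fst) continuous_const).mem_nhds hp.1
  have o2 : ∀ᶠ q : Pt n in 𝓝 p, -1 < q.2 :=
    (isOpen_lt continuous_const continuous_snd).mem_nhds hp.2.1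
  filter_upwards [(hc.mono_left nhdsWithin_le_nhds).eventually (o1.and o2), self_mem_nhdsWithin] with q h1 h3
  rw [mem_Q1p] at h3 ⊢
  refine ⟨h1.1, h1.2, ?_, ?_⟩
  · simp only [scl]
    have := inv_pos.2 hT
    nlinarith [h3.2.2.1]
  · simp only [scl, xlast_smul]
    exact mul_pos (inv_pos.2 hr) h3.2.2.2

/-- The rescaled function. -/
def resc {n : ℕ} [NeZero n] (c r T a : ℝ) (u : Pt n → ℝ) (p : Pt n) : ℝ :=
  (u (scl r T p) - a * xlast (scl r T p).1) / c

lemma key_identity {n : ℕ} [NeZero n] {γ c r a F : ℝ} (hr : 0 < r) (hc : 0 < c) 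
    {φ : Pt n → ℝ} (h : IsTestFn φ) {p : Pt n} (hp : p ∈ Q1p n γ) :
    timeD φ p - xlast p.1 ^ γ * F = r ^ (2 - γ) / c *
      (timeD (psi c r (r ^ (2 - γ)) a φ) (scl r (r ^ (2 - γ)) p) -
        xlast (scl r (r ^ (2 - γ)) p).1 ^ γ * ((c * r⁻¹ ^ 2) * F)) := by
  have hT : 0 < r ^ (2 - γ) := Real.rpow_pos_of_pos hr _
  rw [timeD_psi hr.ne' hT.ne' h]
  rw [mem_Q1p] at hp
  have e : xlast (scl r (r ^ (2 - γ)) p).1 = r * xlast p.1 := rfl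
  rw [e, Real.mul_rpow hr.le hp.2.2.2.le]
  have e2 : r ^ (2 - γ) * r ^ γ = r ^ 2 := by
    rw [← Real.rpow_add hr, sub_add_cancel]; exact_mod_cast Real.rpow_natCast r 2
  have e3 : r ^ (2 - γ) / c * (r ^ γ * xlast p.1 ^ γ * (c * r⁻¹ ^ 2 * F)) = xlast p.1 ^ γ * F := by
    calc _ = (r ^ (2 - γ) * r ^ γ) * r⁻¹ ^ 2 * (c / c) * (xlast p.1 ^ γ * F) := by ring
      _ = _ := by rw [e2, div_self hc.ne']; field_simp
  rw [mul_sub, e3]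
  field_simp

lemma inSstar_resc {n : ℕ} [NeZero n] {γ lam Lam c r a : ℝ} (hγ : γ < 1) (hr : 0 < r) (hr1 : r ≤ 1)
    (hc : 0 < c) {f u : Pt n → ℝ} (hu : InSstar γ lam Lam f u (Q1p n γ)) :
    InSstar γ lam Lam (fun _ => r ^ (2 - γ) / c * supAbs f (Q1p n γ))
      (resc c r (r ^ (2 - γ)) a u) (Q1p n γ) := by
  have hT : 0 < r ^ (2 - γ) := Real.rpow_pos_of_pos hr _
  have hTc : 0 < r ^ (2 - γ) / c := div_pos hT hc
  have hcr : 0 ≤ c * r⁻¹ ^ 2 := by positivity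
  unfold InSstar
  rw [supAbs_const (mul_nonneg hTc.le (supAbs_nonneg _ _))]
  constructor
  · intro p hp φ hφ ht
    have := hu.1 _ (scl_mem_Q1p hγ hr hr1 hp) _ (isTestFn_psi c r (r ^ (2 - γ)) a hφ) ⟨?_, ?_⟩
    · rw [key_identity (a := a) hr hc hφ hp]
      refine mul_le_mul_of_nonneg_left ?_ hTc.le
      simpa only [hess_psi hr.ne' hT.ne' hφ, pucciPlus_smul lam Lam hcr] using this
    · have h1 := ht.1
      rw [psi, scl_inv hr.ne' hT.ne', ← h1, resc]
      field_simp
      ring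
    · filter_upwards [(tendsto_scl hr hp).eventually ht.2] with q hq
      rw [resc, scl_inv' hr.ne' hT.ne', div_le_iff₀ hc] at hq
      rw [psi]
      linarith
  · intro p hp φ hφ ht
    have := hu.2 _ (scl_mem_Q1p hγ hr hr1 hp) _ (isTestFn_psi c r (r ^ (2 - γ)) a hφ) ⟨?_, ?_⟩
    · rw [key_identity (a := a) hr hc hφ hp, ← mul_neg]
      refine mul_le_mul_of_nonneg_left ?_ hTc.le
      simpa only [hess_psi hr.ne' hT.ne' hφ, pucciMinus_smul lam Lam hcr] using this
    · have h1 := ht.1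
      rw [psi, scl_inv hr.ne' hT.ne', ← h1, resc]
      field_simp
      ring
    · filter_upwards [(tendsto_scl hr hp).eventually ht.2] with q hq
      rw [resc, scl_inv' hr.ne' hT.ne', le_div_iff₀ hc] at hq
      rw [psi]
      linarith

lemma touchAbove_congr {n : ℕ} {u v φ : Pt n → ℝ} {Ω : Set (Pt n)} {p : Pt n} (hp : p ∈ Ω)
    (huv : ∀ q ∈ Ω, u q = v q) (h : TouchAbove v φ Ω p) : TouchAbove u φ Ω p := by
  refine ⟨(huv p hp).trans h.1, ?_⟩
  filter_upwards [h.2, self_mem_nhdsWithin] with q h1 h2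
  rwa [huv q h2]

lemma touchBelow_congr {n : ℕ} {u v φ : Pt n → ℝ} {Ω : Set (Pt n)} {p : Pt n} (hp : p ∈ Ω)
    (huv : ∀ q ∈ Ω, u q = v q) (h : TouchBelow v φ Ω p) : TouchBelow u φ Ω p := by
  refine ⟨(huv p hp).trans h.1, ?_⟩
  filter_upwards [h.2, self_mem_nhdsWithin] with q h1 h2
  rwa [huv q h2]

lemma inSstar_congr {n : ℕ} [NeZero n] {γ lam Lam : ℝ} {f u v : Pt n → ℝ} {Ω : Set (Pt n)}
    (huv : ∀ q ∈ Ω, u q = v q) (h : InSstar γ lam Lam f u Ω) : InSstar γ lam Lam f v Ω :=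
  ⟨fun p hp φ hφ ht => h.1 p hp φ hφ (touchAbove_congr hp huv ht),
   fun p hp φ hφ ht => h.2 p hp φ hφ (touchBelow_congr hp huv ht)⟩

lemma g_bound {n : ℕ} [NeZero n] {γ α δ : ℝ} (hγ : γ < 1) (hα : 0 < α) (hδ : 0 < δ) {p : Pt n}
    (hp : p ∈ flatQ1p n γ) :
    δ / 2 ^ (1 + α) * (eucNorm p.1 + |p.2| ^ ((1:ℝ)/(2-γ))) ^ (1 + α) ≤ δ := by
  obtain ⟨h1, h2, h3, _⟩ := closure_bounds hp.1.1
  have h4 : |p.2| ≤ 1 := by rw [abs_le]; constructor <;> linarith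
  have h5 : |p.2| ^ ((1:ℝ)/(2-γ)) ≤ 1 :=
    Real.rpow_le_one (abs_nonneg _) h4 (by apply div_nonneg <;> linarith)
  have h6 : (eucNorm p.1 + |p.2| ^ ((1:ℝ)/(2-γ))) ^ (1 + α) ≤ 2 ^ (1 + α) := by
    refine Real.rpow_le_rpow ?_ (by linarith) (by linarith)
    exact add_nonneg (eucNorm_nonneg _) (Real.rpow_nonneg (abs_nonneg _) _)
  have h7 : (0:ℝ) < 2 ^ (1 + α) := by positivity
  calc _ ≤ δ / 2 ^ (1 + α) * 2 ^ (1 + α) := by gcongr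
    _ = δ := by field_simp

lemma scl_flat {n : ℕ} [NeZero n] {γ r : ℝ} (hγ : γ < 1) (hr : 0 < r) (hr1 : r ≤ 1) {p : Pt n}
    (hp : p ∈ flatQ1p n γ) : scl r (r ^ (2 - γ)) p ∈ flatQ1p n γ := by
  have hx : xlast (scl r (r ^ (2 - γ)) p).1 = 0 := by
    change r * xlast p.1 = 0
    rw [hp.2, mul_zero]
  refine ⟨⟨?_, ?_⟩, hx⟩
  · exact map_mem_closure (continuous_scl r _) hp.1.1 fun q hq => scl_mem_Q1p hγ hr hr1 hq
  · intro h
    rw [mem_Q1p] at h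
    linarith [h.2.2.2]

/-- One step of the iteration. -/
lemma step
    (n : ℕ) [NeZero n] (γ lam Lam C₁ α δ η : ℝ)
    (hγ : γ < 1) (hα : 0 < α) (hα' : α ≤ 1 - γ)
    (hδ : 0 < δ) (hη : 0 < η)
    (happrox : ∀ v f' g' : Pt n → ℝ,
      ContinuousOn v (closure (Q1p n γ)) →
      InSstar γ lam Lam f' v (Q1p n γ) →
      (∀ p ∈ flatQ1p n γ, v p = g' p) →
      supAbs v (Q1p n γ) ≤ 1 →
      supAbs f' (Q1p n γ) ≤ δ →
      supAbs g' (flatQ1p n γ) ≤ δ →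
      ∃ a : ℝ, |a| ≤ C₁ ∧
        ∀ p ∈ Qp γ η (0 : Fin n → ℝ) 0, |v p - a * xlast p.1| ≤ η ^ (1 + α))
    (u f g : Pt n → ℝ)
    (hu : ContinuousOn u (closure (Q1p n γ)))
    (huS : InSstar γ lam Lam f u (Q1p n γ))
    (hug : ∀ p ∈ flatQ1p n γ, u p = g p)
    (hf : supAbs f (Q1p n γ) ≤ δ)
    (hg : ∀ p ∈ flatQ1p n γ,
      |g p| ≤ δ / 2 ^ (1 + α) * (eucNorm p.1 + |p.2| ^ ((1:ℝ)/(2-γ))) ^ (1 + α))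
    (r a : ℝ) (hr : 0 < r) (hr1 : r ≤ 1)
    (ha : ∀ p ∈ Qp γ r (0 : Fin n → ℝ) 0, |u p - a * xlast p.1| ≤ r ^ (1 + α)) :
    ∃ b : ℝ, |b - a| ≤ C₁ * r ^ α ∧
      ∀ p ∈ Qp γ (η * r) (0 : Fin n → ℝ) 0, |u p - b * xlast p.1| ≤ (η * r) ^ (1 + α) := by
  have hc : 0 < r ^ (1 + α) := Real.rpow_pos_of_pos hr _
  have hT : 0 < r ^ (2 - γ) := Real.rpow_pos_of_pos hr _
  have key := happrox (resc (r ^ (1 + α)) r (r ^ (2 - γ)) a u)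
    (fun _ => r ^ (2 - γ) / r ^ (1 + α) * supAbs f (Q1p n γ))
    (resc (r ^ (1 + α)) r (r ^ (2 - γ)) a u) ?_ (inSstar_resc hγ hr hr1 hc huS)
    (fun _ _ => rfl) ?_ ?_ ?_
  · obtain ⟨b, hb, hb'⟩ := key
    refine ⟨a + b * r ^ α, ?_, ?_⟩
    · have : 0 < r ^ α := Real.rpow_pos_of_pos hr _
      rw [add_sub_cancel_left, abs_mul, abs_of_pos this]
      gcongr
    · intro q hq
      rw [← scl_inv' hr.ne' hT.ne' q, scl_mem hr hη] at hq
      have h1 := hb' _ hq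
      rw [resc, scl_inv' hr.ne' hT.ne'] at h1
      have e : xlast (scl r⁻¹ (r ^ (2 - γ))⁻¹ q).1 = r⁻¹ * xlast q.1 := rfl
      have e2 : r ^ (1 + α) = r * r ^ α := by rw [Real.rpow_add hr, Real.rpow_one]
      have h2 : u q - (a + b * r ^ α) * xlast q.1 =
          ((u q - a * xlast q.1) / r ^ (1 + α) - b * (r⁻¹ * xlast q.1)) * r ^ (1 + α) := by
        have : 0 < r ^ α := Real.rpow_pos_of_pos hr _
        rw [e2]
        field_simp
        ring
      rw [h2, abs_mul, abs_of_pos hc, Real.mul_rpow hη.le hr.le]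
      rw [e] at h1
      gcongr
  · have h1 : ContinuousOn (fun p : Pt n => u (scl r (r ^ (2 - γ)) p)) (closure (Q1p n γ)) := by
      refine hu.comp (continuous_scl _ _).continuousOn ?_
      intro p hp
      exact map_mem_closure (continuous_scl r _) hp fun q hq => scl_mem_Q1p hγ hr hr1 hq
    have h2 : Continuous fun p : Pt n => a * xlast (scl r (r ^ (2 - γ)) p).1 :=
      continuous_const.mul (continuous_xlast.comp (continuous_fst.comp (continuous_scl _ _)))
    exact (h1.sub h2.continuousOn).div_const _
  · refine supAbs_le zero_le_one fun p hp => ?_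
    have h1 := (scl_mem (n := n) (γ := γ) hr one_pos (p := p)).2 hp
    rw [one_mul] at h1
    rw [resc, abs_div, abs_of_pos hc, div_le_one hc]
    exact ha _ h1
  · rw [supAbs_const (mul_nonneg (div_pos hT hc).le (supAbs_nonneg _ _))]
    have : r ^ (2 - γ) / r ^ (1 + α) ≤ 1 := by
      rw [div_le_one hc]
      exact Real.rpow_le_rpow_of_exponent_ge hr hr1 (by linarith)
    calc _ ≤ 1 * supAbs f (Q1p n γ) := by
          gcongr
          exact supAbs_nonneg _ _
      _ ≤ δ := by linarith
  · refine supAbs_le hδ.le fun p hp => ?_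
    have hs := scl_flat hγ hr hr1 hp
    rw [resc, hs.2, mul_zero, sub_zero, hug _ hs, abs_div, abs_of_pos hc, div_le_iff₀ hc]
    refine (hg _ hs).trans ?_
    have e1 : eucNorm (scl r (r ^ (2 - γ)) p).1 = r * eucNorm p.1 := eucNorm_smul hr.le _
    have e2 : |(scl r (r ^ (2 - γ)) p).2| ^ ((1:ℝ)/(2-γ)) = r * |p.2| ^ ((1:ℝ)/(2-γ)) := by
      change |r ^ (2 - γ) * p.2| ^ ((1:ℝ)/(2-γ)) = _
      rw [abs_mul, abs_of_pos hT, Real.mul_rpow hT.le (abs_nonneg _), ← Real.rpow_mul hr.le,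
        mul_one_div_cancel (by linarith), Real.rpow_one]
    rw [e1, e2, ← mul_add, Real.mul_rpow hr.le
      (add_nonneg (eucNorm_nonneg _) (Real.rpow_nonneg (abs_nonneg _) _))]
    have := g_bound hγ hα hδ hp
    calc _ = (δ / 2 ^ (1 + α) * (eucNorm p.1 + |p.2| ^ ((1:ℝ)/(2-γ))) ^ (1 + α)) * r ^ (1 + α) := by
          ring
      _ ≤ _ := by gcongr

/-- The approximation step forces `η ≤ 1`. -/
lemma eta_le_one
    (n : ℕ) [NeZero n] (γ lam Lam C₁ α δ η : ℝ)
    (hγ : γ < 1) (hα : 0 < α) (hδ : 0 < δ) 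
    (happrox : ∀ v f' g' : Pt n → ℝ,
      ContinuousOn v (closure (Q1p n γ)) →
      InSstar γ lam Lam f' v (Q1p n γ) →
      (∀ p ∈ flatQ1p n γ, v p = g' p) →
      supAbs v (Q1p n γ) ≤ 1 →
      supAbs f' (Q1p n γ) ≤ δ →
      supAbs g' (flatQ1p n γ) ≤ δ →
      ∃ a : ℝ, |a| ≤ C₁ ∧
        ∀ p ∈ Qp γ η (0 : Fin n → ℝ) 0, |v p - a * xlast p.1| ≤ η ^ (1 + α))
    (u f g : Pt n → ℝ)
    (hu : ContinuousOn u (closure (Q1p n γ)))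
    (huS : InSstar γ lam Lam f u (Q1p n γ))
    (hug : ∀ p ∈ flatQ1p n γ, u p = g p)
    (hu1 : supAbs u (Q1p n γ) ≤ 1)
    (hf : supAbs f (Q1p n γ) ≤ δ)
    (hg : ∀ p ∈ flatQ1p n γ,
      |g p| ≤ δ / 2 ^ (1 + α) * (eucNorm p.1 + |p.2| ^ ((1:ℝ)/(2-γ))) ^ (1 + α)) :
    η ≤ 1 := by
  classical
  by_contra hη
  push Not at hη
  obtain ⟨q, hq⟩ := Q1p_nonempty n γ
  -- a point of the large cylinder below the unit cylinder
  obtain ⟨t, ht1, ht2⟩ := exists_between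
    (neg_lt_neg (Real.one_lt_rpow hη (by linarith : 0 < 2 - γ)))
  have hq' := mem_Q1p.1 hq
  set P : Pt n := (q.1, t) with hP
  have hPη : P ∈ Qp γ η (0 : Fin n → ℝ) 0 := by
    rw [mem_Qp]
    exact ⟨by simp only [hP]; linarith [hq'.1], ht1, by simp only [hP]; linarith, hq'.2.2.2⟩
  have hPn : P ∉ closure (Q1p n γ) := by
    intro h
    have := (closure_bounds h).2.1
    simp only [hP] at this
    linarith
  set v : Pt n → ℝ := fun p => if p = P then C₁ * xlast q.1 + η ^ (1 + α) + 1 else u p with hv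
  have hvu : ∀ p ∈ closure (Q1p n γ), u p = v p := by
    intro p hp
    have : p ≠ P := fun h => hPn (h ▸ hp)
    simp [hv, this]
  obtain ⟨a, ha, ha'⟩ := happrox v f g (hu.congr fun p hp => (hvu p hp).symm)
    (inSstar_congr (fun p hp => hvu p (subset_closure hp)) huS)
    (fun p hp => by rw [← hvu p hp.1.1, hug p hp])
    (supAbs_le zero_le_one fun p hp => by
      rw [← hvu p (subset_closure hp)]
      exact (abs_le_supAbs hu hp).trans hu1) hf
    (supAbs_le hδ.le fun p hp => (hg p hp).trans (g_bound hγ hα hδ hp))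
  have h1 := ha' P hPη
  have h2 : v P = C₁ * xlast q.1 + η ^ (1 + α) + 1 := by simp [hv]
  rw [h2] at h1
  have h3 := le_of_abs_le h1
  have h4 := le_of_abs_le ha
  have h5 := mul_le_mul_of_nonneg_right h4 hq'.2.2.2.le
  change C₁ * xlast q.1 + η ^ (1 + α) + 1 - a * xlast q.1 ≤ _ at h3
  linarith

end DPP

/-- **Iteration for the boundary `C^{1,α}` estimate** (Lemma 3.5).
The sequence `{a_k}_{k=-1}^∞` is encoded by `a : ℕ → ℝ` with the index shifted by one,
so that `a 0 = a_{-1}`, `a (k+1) = a_k`. -/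
theorem iteration_C1alpha
    (n : ℕ) [NeZero n] (hn : 2 ≤ n) (γ lam Lam abar C₁ α δ η : ℝ)
    (hγ : γ < 1) (hlam : 0 < lam) (hlamLam : lam ≤ Lam)
    (habar : abar ∈ Set.Ioo (0 : ℝ) 1) (hC₁ : 1 < C₁)
    (hmodel : ModelEstimate n γ lam Lam abar C₁)
    (hα : α ∈ Set.Ioo 0 abar) (hα' : α ≤ 1 - γ)
    (hδ : 0 < δ) (hη : 0 < η)
    -- δ and η are the constants of the approximation step for this α:
    (happrox : ∀ v f' g' : Pt n → ℝ,
      ContinuousOn v (closure (Q1p n γ)) →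
      InSstar γ lam Lam f' v (Q1p n γ) →
      (∀ p ∈ flatQ1p n γ, v p = g' p) →
      supAbs v (Q1p n γ) ≤ 1 →
      supAbs f' (Q1p n γ) ≤ δ →
      supAbs g' (flatQ1p n γ) ≤ δ →
      ∃ a : ℝ, |a| ≤ C₁ ∧
        ∀ p ∈ Qp γ η (0 : Fin n → ℝ) 0, |v p - a * xlast p.1| ≤ η ^ (1 + α))
    (u f g : Pt n → ℝ)
    (hu : ContinuousOn u (closure (Q1p n γ)))
    (huS : InSstar γ lam Lam f u (Q1p n γ))
    (hug : ∀ p ∈ flatQ1p n γ, u p = g p)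
    (hu1 : supAbs u (Q1p n γ) ≤ 1)
    (hf : supAbs f (Q1p n γ) ≤ δ)
    (hg : ∀ p ∈ flatQ1p n γ,
      |g p| ≤ δ / 2 ^ (1 + α) * (eucNorm p.1 + |p.2| ^ ((1:ℝ)/(2-γ))) ^ (1 + α)) :
    ∃ a : ℕ → ℝ, a 0 = 0 ∧ a 1 = 0 ∧
      ∀ k : ℕ,
        (∀ p ∈ Qp γ (η ^ k) (0 : Fin n → ℝ) 0,
          |u p - a (k+1) * xlast p.1| ≤ η ^ ((k : ℝ) * (1 + α))) ∧
        |a (k+1) - a k| ≤ C₁ * η ^ (((k : ℝ) - 1) * α) := by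
  have hα0 : 0 < α := hα.1
  have hη1 : η ≤ 1 := eta_le_one n γ lam Lam C₁ α δ η hγ hα0 hδ happrox u f g hu huS hug hu1 hf hg
  have hpow : ∀ k : ℕ, η ^ ((k : ℝ) * (1 + α)) = (η ^ k) ^ (1 + α) := by
    intro k
    rw [Real.rpow_mul hη.le, Real.rpow_natCast]
  have hstep : ∀ (k : ℕ) (a : ℝ), ∃ b : ℝ,
      (∀ p ∈ Qp γ (η ^ k) (0 : Fin n → ℝ) 0, |u p - a * xlast p.1| ≤ (η ^ k) ^ (1 + α)) →
      |b - a| ≤ C₁ * (η ^ k) ^ α ∧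
      ∀ p ∈ Qp γ (η ^ (k + 1)) (0 : Fin n → ℝ) 0,
        |u p - b * xlast p.1| ≤ (η ^ (k + 1)) ^ (1 + α) := by
    intro k a
    by_cases h : ∀ p ∈ Qp γ (η ^ k) (0 : Fin n → ℝ) 0,
        |u p - a * xlast p.1| ≤ (η ^ k) ^ (1 + α)
    · obtain ⟨b, hb⟩ := step n γ lam Lam C₁ α δ η hγ hα0 hα' hδ hη happrox u f g hu huS hug hf hg
        (η ^ k) a (pow_pos hη k) (pow_le_one₀ hη.le hη1) h
      refine ⟨b, fun _ => ?_⟩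
      rwa [pow_succ']
    · exact ⟨0, fun h' => absurd h' h⟩
  choose F hF using hstep
  let A : ℕ → ℝ := fun k => Nat.rec 0 (fun k a => F k a) k
  have hA : ∀ k, A (k + 1) = F k (A k) := fun _ => rfl
  have hA0 : A 0 = 0 := rfl
  have hAk : ∀ k : ℕ, ∀ p ∈ Qp γ (η ^ k) (0 : Fin n → ℝ) 0,
      |u p - A k * xlast p.1| ≤ (η ^ k) ^ (1 + α) := by
    intro k
    induction k with
    | zero =>
      intro p hp
      rw [pow_zero] at hp
      simpa [hA0] using (abs_le_supAbs hu hp).trans hu1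
    | succ k ih =>
      rw [hA]
      exact (hF k (A k) ih).2
  refine ⟨fun k => A (k - 1), rfl, rfl, fun k => ⟨?_, ?_⟩⟩
  · intro p hp
    rw [hpow]
    exact hAk k p hp
  · cases k with
    | zero =>
      have : 0 < C₁ := by linarith
      simpa using by positivity
    | succ k =>
      have h := (hF k (A k) (hAk k)).1
      rw [← hA, ← Real.rpow_natCast, ← Real.rpow_mul hη.le] at h
      simpa using h
end
end

section
/- Explicit solution of the homogeneous degenerate equation: Let 0 < γ < 1, let l : ℝ^n → ℝ be any affine function, and define u(x,t) = l(x) + t x_n + x_n^{3−γ}/((3−γ)(2−γ)) on {x ∈ ℝ^n : x_n > 0} × ℝ. Then u is a classical (hence viscosity) solution of u_t − x_n^γ Δu = 0 in {x_n > 0} × ℝ, and its Hessian satisfies ‖D²u(x,t)‖ = x_n^{1−γ}; in particular u is exactly C^{2,1−γ} up to the flat boundary {x_n = 0} and no better. -/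
noncomputable section

open Real Topology Filter Set MeasureTheory

open DPP

theorem DPP.fderiv_aux {n : ℕ} [NeZero n] (γ : ℝ) (hγ1 : γ < 1)
    (l : (Fin n → ℝ) →ᵃ[ℝ] ℝ) (t : ℝ) (x : Fin n → ℝ) (hx : 0 < xlast x) :
    HasFDerivAt (fun y : Fin n → ℝ =>
        l y + t * xlast y + xlast y ^ (3 - γ) / ((3 - γ) * (2 - γ)))
      (LinearMap.toContinuousLinearMap l.linear +
        (t + xlast x ^ (2 - γ) / (2 - γ)) •
          (ContinuousLinearMap.proj (R := ℝ) (φ := fun _ : Fin n => ℝ) (lastIdx n))) x := by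
  have hl : HasFDerivAt (fun y : Fin n → ℝ => l y)
      (LinearMap.toContinuousLinearMap l.linear) x := by
    have h1 : (fun y : Fin n → ℝ => l y) =
        fun y => LinearMap.toContinuousLinearMap l.linear y + l 0 := by
      funext y
      have := congrFun (AffineMap.decomp l) y
      simpa using this
    rw [h1]
    exact (ContinuousLinearMap.hasFDerivAt _).add_const _
  have hp : HasFDerivAt (fun y : Fin n → ℝ => xlast y)
      (ContinuousLinearMap.proj (R := ℝ) (φ := fun _ : Fin n => ℝ) (lastIdx n)) x :=
    (ContinuousLinearMap.proj (R := ℝ) (φ := fun _ : Fin n => ℝ) (lastIdx n)).hasFDerivAt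
  have hr : HasDerivAt (fun s : ℝ => t * s + s ^ (3 - γ) / ((3 - γ) * (2 - γ)))
      (t + xlast x ^ (2 - γ) / (2 - γ)) (xlast x) := by
    have h1 := ((hasDerivAt_id (xlast x)).const_mul t).add
      ((Real.hasDerivAt_rpow_const (p := 3 - γ) (Or.inl hx.ne')).div_const ((3 - γ) * (2 - γ)))
    refine h1.congr_deriv ?_
    have e : 3 - γ - 1 = 2 - γ := by ring
    have h3 : 3 - γ ≠ 0 := by linarith
    have h2 : 2 - γ ≠ 0 := by linarith
    rw [e]
    field_simp
  have h := hl.add (hr.comp_hasFDerivAt x hp)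
  refine h.congr_of_eventuallyEq (Eventually.of_forall fun y => ?_)
  simp [add_assoc]

theorem DPP.hess_aux {n : ℕ} [NeZero n] (γ : ℝ) (hγ1 : γ < 1)
    (l : (Fin n → ℝ) →ᵃ[ℝ] ℝ) (p : Pt n) (hx : 0 < xlast p.1) (i j : Fin n) :
    hess (fun p : Pt n =>
        l p.1 + p.2 * xlast p.1 + xlast p.1 ^ (3 - γ) / ((3 - γ) * (2 - γ))) p i j =
      if i = lastIdx n then (if j = lastIdx n then xlast p.1 ^ (1 - γ) else 0) else 0 := by
  have hp : HasFDerivAt (fun y : Fin n → ℝ => xlast y)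
      (ContinuousLinearMap.proj (R := ℝ) (φ := fun _ : Fin n => ℝ) (lastIdx n)) p.1 :=
    (ContinuousLinearMap.proj (R := ℝ) (φ := fun _ : Fin n => ℝ) (lastIdx n)).hasFDerivAt
  have hopen : ∀ᶠ x in 𝓝 p.1, 0 < xlast x :=
    hp.continuousAt.eventually (lt_mem_nhds hx)
  set c : ℝ := (Pi.single j 1 : Fin n → ℝ) (lastIdx n) with hc
  have hev : (fun x => fderiv ℝ (fun y : Fin n → ℝ =>
        l y + p.2 * xlast y + xlast y ^ (3 - γ) / ((3 - γ) * (2 - γ))) x (Pi.single j 1))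
      =ᶠ[𝓝 p.1] fun x => l.linear (Pi.single j 1) + (p.2 + xlast x ^ (2 - γ) / (2 - γ)) * c := by
    filter_upwards [hopen] with x hx
    rw [(DPP.fderiv_aux γ hγ1 l p.2 x hx).fderiv]
    simp [hc]
  have hr : HasDerivAt (fun s : ℝ => l.linear (Pi.single j 1) + (p.2 + s ^ (2 - γ) / (2 - γ)) * c)
      (xlast p.1 ^ (1 - γ) * c) (xlast p.1) := by
    have h1 := ((((Real.hasDerivAt_rpow_const (p := 2 - γ) (Or.inl hx.ne')).div_const
      (2 - γ)).const_add p.2).mul_const c).const_add (l.linear (Pi.single j 1))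
    refine h1.congr_deriv ?_
    have e : 2 - γ - 1 = 1 - γ := by ring
    have h2 : 2 - γ ≠ 0 := by linarith
    rw [e]
    field_simp
  have h := (hr.comp_hasFDerivAt p.1 hp).congr_of_eventuallyEq hev
  unfold hess
  rw [h.fderiv]
  by_cases hi : i = lastIdx n <;> by_cases hj : j = lastIdx n <;>
    simp [hc, hi, hj, Pi.single_apply, eq_comm]

/-- **Explicit solution of the homogeneous degenerate equation** (Remark 1.4):
for an affine `l`, `u(x,t) = l(x) + t x_n + x_n^{3-γ}/((3-γ)(2-γ))` is a classical
(hence viscosity) solution of `u_t - x_n^γ Δu = 0` in `{x_n > 0} × ℝ` with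
`‖D²u‖ = x_n^{1-γ}`. -/
theorem explicit_solution_homogeneous
    (n : ℕ) [NeZero n] (γ : ℝ) (hγ0 : 0 < γ) (hγ1 : γ < 1)
    (l : (Fin n → ℝ) →ᵃ[ℝ] ℝ)
    (u : Pt n → ℝ)
    (hu : u = fun p => l p.1 + p.2 * xlast p.1 + xlast p.1 ^ (3 - γ) / ((3 - γ) * (2 - γ))) :
    ∀ p : Pt n, 0 < xlast p.1 →
      ContDiffAt ℝ 2 (fun x => u (x, p.2)) p.1 ∧
      HasDerivAt (fun s => u (p.1, s)) (xlast p.1) p.2 ∧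
      timeD u p - xlast p.1 ^ γ * (hess u p).trace = 0 ∧
      matNorm (hess u p) = xlast p.1 ^ (1 - γ) := by
  subst hu
  intro p hx
  have hd : HasDerivAt (fun s : ℝ => l p.1 + s * xlast p.1 +
      xlast p.1 ^ (3 - γ) / ((3 - γ) * (2 - γ))) (xlast p.1) p.2 := by
    have := (((hasDerivAt_id p.2).mul_const (xlast p.1)).const_add (l p.1)).add_const
      (xlast p.1 ^ (3 - γ) / ((3 - γ) * (2 - γ)))
    simpa using this
  have hH := DPP.hess_aux γ hγ1 l p hx
  refine ⟨?_, hd, ?_, ?_⟩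
  · have hp : ContDiffAt ℝ 2 (fun y : Fin n → ℝ => xlast y) p.1 :=
      (ContinuousLinearMap.proj (R := ℝ) (φ := fun _ : Fin n => ℝ) (lastIdx n)).contDiff.contDiffAt
    have hl : ContDiffAt ℝ 2 (fun y : Fin n → ℝ => l y) p.1 := by
      have h1 : (fun y : Fin n → ℝ => l y) =
          fun y => LinearMap.toContinuousLinearMap l.linear y + l 0 := by
        funext y
        have := congrFun (AffineMap.decomp l) y
        simpa using this
      rw [h1]
      exact (ContinuousLinearMap.contDiff _).contDiffAt.add contDiffAt_const
    exact (hl.add (contDiffAt_const.mul hp)).add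
      ((hp.rpow_const_of_ne hx.ne').div_const _)
  · have ht : timeD (fun p : Pt n =>
        l p.1 + p.2 * xlast p.1 + xlast p.1 ^ (3 - γ) / ((3 - γ) * (2 - γ))) p = xlast p.1 :=
      hd.deriv
    rw [ht]
    simp only [Matrix.trace, Matrix.diag, hH]
    have : ∀ i : Fin n, (if i = lastIdx n then (if i = lastIdx n then xlast p.1 ^ (1 - γ) else 0)
        else 0) = if i = lastIdx n then xlast p.1 ^ (1 - γ) else 0 := by
      intro i; split_ifs <;> rfl
    simp only [this, Finset.sum_ite_eq', Finset.sum_ite_eq, Finset.mem_univ, if_true]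
    rw [← Real.rpow_add hx]
    simp
  · unfold matNorm
    have : ∀ i j : Fin n, (hess (fun p : Pt n =>
        l p.1 + p.2 * xlast p.1 + xlast p.1 ^ (3 - γ) / ((3 - γ) * (2 - γ))) p i j) ^ 2 =
        if i = lastIdx n then (if j = lastIdx n then (xlast p.1 ^ (1 - γ)) ^ 2 else 0) else 0 := by
      intro i j
      rw [hH]
      split_ifs <;> simp
    simp only [this]
    rw [Finset.sum_eq_single (lastIdx n)]
    · simp only [if_true, Finset.sum_ite_eq', Finset.sum_ite_eq, Finset.mem_univ]
      exact Real.sqrt_sq (Real.rpow_nonneg hx.le _)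
    · intro b _ hb
      simp [hb]
    · simp
end
end
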